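/- Distributional Fourier transform of log x (branch with log(−1) = −iπ): Define L : ℝ∖{0} → ℂ by L(x) = log|x| for x > 0 and L(x) = log|x| − iπ for x < 0. Then for every Schwartz function φ : ℝ → ℂ with Fourier transform φ̂(k) = ∫_ℝ φ(x)e^{−ikx}dx, ∫_ℝ L(x)·φ̂(x) dx = −2π·( ∫_{−1≤x<0} (φ(x) − φ(0))/|x| dx + ∫_{x<−1} φ(x)/|x| dx ) − (2πγ + iπ²)·φ(0), where γ is the Euler–Mascheroni constant. -/

import Mathlib

open MeasureTheory Real

/-- The Fourier transform `φ̂(k) = ∫ φ(x) e^{−ikx} dx` of a Schwartz function. -/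
noncomputable def fourierT (φ : SchwartzMap ℝ ℂ) (k : ℝ) : ℂ :=
  ∫ x : ℝ, φ x * Complex.exp (-Complex.I * (k : ℂ) * (x : ℂ))

/-- The complex logarithm of a real number in the branch with `log(−1) = −iπ`. -/
noncomputable def branchLog (x : ℝ) : ℂ :=
  if x < 0 then ((Real.log |x| : ℝ) : ℂ) - Complex.I * (π : ℂ) else ((Real.log |x| : ℝ) : ℂ)

theorem norm_exp_neg_mul_sub_le {m t : ℝ} (ht : 0 ≤ t) {a b : ℂ} (ha : m ≤ a.re) (hb : m ≤ b.re) :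
    ‖Complex.exp (-t * a) - Complex.exp (-t * b)‖ ≤ t * rexp (-m * t) * ‖a - b‖ := by
  refine Convex.norm_image_sub_le_of_norm_hasDerivWithin_le (𝕜 := ℂ)
    (f := fun w => Complex.exp (-t * w)) (f' := fun w => Complex.exp (-t * w) * (-t))
    (s := {w : ℂ | m ≤ w.re}) ?_ ?_ (convex_halfSpace_re_ge m) hb ha
  · intro w _
    have := ((hasDerivAt_id w).const_mul (-t : ℂ)).cexp
    simpa using this.hasDerivWithinAt
  · intro w hw
    have hw : m ≤ w.re := hw
    rw [norm_mul, Complex.norm_exp, norm_neg, Complex.norm_real, Real.norm_of_nonneg ht, mul_comm]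
    gcongr
    simp
    nlinarith

theorem norm_frullani_integrand_le {m t : ℝ} (ht : 0 < t) {z : ℂ} (hm : m ≤ 1) (hz : m ≤ z.re) :
    ‖(Complex.exp (-t) - Complex.exp (-t * z)) / t‖ ≤ rexp (-m * t) * ‖1 - z‖ := by
  have h := norm_exp_neg_mul_sub_le ht.le (a := 1) (by simpa using hm) hz
  rw [mul_one] at h
  rw [norm_div, Complex.norm_real, Real.norm_of_nonneg ht.le, div_le_iff₀ ht]
  linarith

theorem aestronglyMeasurable_frullani_integrand (z : ℂ) :
    AEStronglyMeasurable (fun t : ℝ => (Complex.exp (-t) - Complex.exp (-t * z)) / t)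
      (volume.restrict (Set.Ioi 0)) :=
  (by fun_prop : Measurable fun t : ℝ => (Complex.exp (-t) - Complex.exp (-t * z)) / t)
    |>.aestronglyMeasurable

theorem integrableOn_frullani_integrand {z : ℂ} (hz : 0 < z.re) :
    IntegrableOn (fun t : ℝ => (Complex.exp (-t) - Complex.exp (-t * z)) / t) (Set.Ioi 0) := by
  have hm : 0 < min 1 z.re := lt_min one_pos hz
  refine Integrable.mono' (((exp_neg_integrableOn_Ioi 0 hm)).mul_const ‖1 - z‖)
    (aestronglyMeasurable_frullani_integrand z) ?_
  filter_upwards [ae_restrict_mem measurableSet_Ioi] with t ht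
  exact norm_frullani_integrand_le ht (min_le_left _ _) (min_le_right _ _)

theorem hasDerivAt_integral_frullani {z : ℂ} (hz : 0 < z.re) :
    HasDerivAt (fun w : ℂ => ∫ t in Set.Ioi (0 : ℝ), (Complex.exp (-t) - Complex.exp (-t * w)) / t)
      z⁻¹ z := by
  have hd := (hasDerivAt_integral_of_dominated_loc_of_deriv_le (𝕜 := ℂ)
    (μ := volume.restrict (Set.Ioi (0 : ℝ)))
    (F := fun (w : ℂ) (t : ℝ) => (Complex.exp (-t) - Complex.exp (-t * w)) / t)
    (F' := fun (w : ℂ) (t : ℝ) => Complex.exp (-t * w)) (x₀ := z)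
    (s := {w : ℂ | z.re / 2 < w.re})
    (bound := fun t => rexp (-(z.re / 2) * t))
    ((isOpen_lt continuous_const Complex.continuous_re).mem_nhds (by simp; linarith))
    (.of_forall aestronglyMeasurable_frullani_integrand)
    (integrableOn_frullani_integrand hz) (by fun_prop) ?_
    (exp_neg_integrableOn_Ioi 0 (half_pos hz)) ?_).2
  · refine hd.congr_deriv ?_
    have := integral_exp_mul_complex_Ioi (a := -z) (by simpa using hz) 0
    simp only [Complex.ofReal_zero, mul_zero, Complex.exp_zero, neg_div_neg_eq, one_div] at this
    rw [← this]
    simp_rw [neg_mul, mul_comm]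
  · filter_upwards [ae_restrict_mem measurableSet_Ioi] with t ht w hw
    have ht : 0 < t := ht
    have hw : z.re / 2 < w.re := hw
    rw [Complex.norm_exp]
    gcongr
    simp
    nlinarith
  · filter_upwards [ae_restrict_mem measurableSet_Ioi] with t ht w hw
    have ht : (t : ℂ) ≠ 0 := by exact_mod_cast (ne_of_gt ht)
    refine ((((hasDerivAt_id w).const_mul (-t : ℂ)).cexp.const_sub
      (Complex.exp (-t))).div_const (t : ℂ)).congr_deriv ?_
    simp only [id, mul_one]
    field_simp

/-- Frullani's integral for the exponential, with a complex parameter. -/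
theorem integral_frullani_exp {z : ℂ} (hz : 0 < z.re) :
    ∫ t in Set.Ioi (0 : ℝ), (Complex.exp (-t) - Complex.exp (-t * z)) / t = Complex.log z := by
  have hopen : IsOpen {w : ℂ | 0 < w.re} := isOpen_lt continuous_const Complex.continuous_re
  have hd : ∀ w : ℂ, 0 < w.re → HasDerivAt (fun w : ℂ => (∫ t in Set.Ioi (0 : ℝ),
      (Complex.exp (-t) - Complex.exp (-t * w)) / t) - Complex.log w) 0 w := fun w hw => by
    simpa using (hasDerivAt_integral_frullani hw).fun_sub (Complex.hasDerivAt_log (.inl hw))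
  have := hopen.is_const_of_deriv_eq_zero (convex_halfSpace_re_gt 0).isPreconnected
    (fun w hw => (hd w hw).differentiableAt.differentiableWithinAt)
    (fun w hw => (hd w hw).deriv) hz (show (0 : ℝ) < (1 : ℂ).re by simp)
  simpa [sub_eq_zero] using this
theorem abs_exp_neg_sub_one_le {t : ℝ} (ht : 0 ≤ t) : |rexp (-t) - 1| ≤ t := by
  have h1 : rexp (-t) ≤ 1 := Real.exp_le_one_iff.2 (by linarith)
  have h2 := Real.add_one_le_exp (-t)
  rw [abs_le]
  constructor <;> linarith

theorem integrableOn_exp_neg_sub_one_div :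
    IntegrableOn (fun t : ℝ => (rexp (-t) - 1) / t) (Set.Ioc 0 1) := by
  refine Measure.integrableOn_of_bounded (M := 1) (by simp)
    (by fun_prop : Measurable fun t : ℝ => (rexp (-t) - 1) / t).aestronglyMeasurable ?_
  filter_upwards [ae_restrict_mem measurableSet_Ioc] with t ht
  rw [norm_div, Real.norm_eq_abs, Real.norm_of_nonneg ht.1.le, div_le_one ht.1]
  exact abs_exp_neg_sub_one_le ht.1.le

theorem integrableOn_exp_neg_div :
    IntegrableOn (fun t : ℝ => rexp (-t) / t) (Set.Ioi 1) := by
  refine Integrable.mono' (integrableOn_exp_neg_Ioi 1)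
    (by fun_prop : Measurable fun t : ℝ => rexp (-t) / t).aestronglyMeasurable ?_
  filter_upwards [ae_restrict_mem measurableSet_Ioi] with t ht
  have ht : 1 < t := ht
  rw [norm_div, Real.norm_of_nonneg (Real.exp_pos _).le, Real.norm_of_nonneg (by linarith)]
  exact div_le_self (Real.exp_pos _).le ht.le

theorem integrableOn_log_mul_exp_neg_Ioc :
    IntegrableOn (fun t : ℝ => log t * rexp (-t)) (Set.Ioc 0 1) := by
  rw [← intervalIntegrable_iff_integrableOn_Ioc_of_le zero_le_one]
  exact intervalIntegral.intervalIntegrable_log'.mul_continuousOn (by fun_prop)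

theorem integrableOn_log_mul_exp_neg_Ioi :
    IntegrableOn (fun t : ℝ => log t * rexp (-t)) (Set.Ioi 1) := by
  have h := (Real.GammaIntegral_convergent (s := 2) two_pos).mono_set
    (Set.Ioi_subset_Ioi zero_le_one)
  refine Integrable.mono' h (by fun_prop :
    Measurable fun t : ℝ => log t * rexp (-t)).aestronglyMeasurable ?_
  filter_upwards [ae_restrict_mem measurableSet_Ioi] with t ht
  have ht : 1 < t := ht
  rw [norm_mul, Real.norm_of_nonneg (log_nonneg ht.le), Real.norm_of_nonneg (Real.exp_pos _).le,
    mul_comm]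
  norm_num
  gcongr
  exact log_le_self (by linarith)

theorem integral_log_mul_exp_neg :
    ∫ t in Set.Ioi (0 : ℝ), log t * rexp (-t) = -eulerMascheroniConstant := by
  have h := Complex.hasDerivAt_GammaIntegral (s := 1) (by simp)
  have h' : HasDerivAt Complex.GammaIntegral (-eulerMascheroniConstant : ℂ) 1 := by
    refine Complex.hasDerivAt_Gamma_one.congr_of_eventuallyEq ?_
    filter_upwards [(isOpen_lt continuous_const Complex.continuous_re).mem_nhds
      (show (0 : ℝ) < (1 : ℂ).re by simp)] with s hs
    exact (Complex.Gamma_eq_integral hs).symm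
  have := h.unique h'
  simp only [sub_self, Complex.cpow_zero, one_mul, ← Complex.ofReal_mul, integral_complex_ofReal,
    ← Complex.ofReal_neg] at this
  exact_mod_cast this

theorem hasDerivAt_log_mul_one_sub_exp_neg {t : ℝ} (ht : 0 < t) :
    HasDerivAt (fun t => log t * (1 - rexp (-t)))
      (log t * rexp (-t) - (rexp (-t) - 1) / t) t := by
  refine ((hasDerivAt_log ht.ne').mul ((hasDerivAt_neg t).exp.const_sub 1)).congr_deriv ?_
  ring

theorem integral_log_mul_exp_neg_Ioc :
    ∫ t in Set.Ioc (0 : ℝ) 1, log t * rexp (-t) = ∫ t in Set.Ioc (0 : ℝ) 1, (rexp (-t) - 1) / t := by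
  have hint := integrableOn_log_mul_exp_neg_Ioc.sub integrableOn_exp_neg_sub_one_div
  have := intervalIntegral.integral_eq_sub_of_hasDerivAt_of_le zero_le_one
    (f := fun t => log t * (1 - rexp (-t))) ?_
    (fun t ht => hasDerivAt_log_mul_one_sub_exp_neg ht.1)
    ((intervalIntegrable_iff_integrableOn_Ioc_of_le zero_le_one).2 hint)
  · rw [intervalIntegral.integral_of_le zero_le_one, integral_sub
      integrableOn_log_mul_exp_neg_Ioc integrableOn_exp_neg_sub_one_div] at this
    simpa [sub_eq_zero] using this
  · intro t ht
    rcases ht.1.eq_or_lt with rfl | h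
    · rw [ContinuousWithinAt]
      simp only [log_zero, zero_mul]
      have hlim : Filter.Tendsto (fun t : ℝ => |t * log t|) (nhdsWithin 0 (Set.Icc 0 1)) (nhds 0) := by
        have := (Real.continuous_mul_log.abs.tendsto 0)
        simp only [log_zero, mul_zero, abs_zero] at this
        exact this.mono_left nhdsWithin_le_nhds
      refine squeeze_zero_norm' ?_ hlim
      filter_upwards [self_mem_nhdsWithin] with s hs
      rw [norm_mul, Real.norm_eq_abs, Real.norm_eq_abs, abs_mul, mul_comm, abs_of_nonneg hs.1,
        abs_sub_comm]
      gcongr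
      exact abs_exp_neg_sub_one_le hs.1
    · exact (hasDerivAt_log_mul_one_sub_exp_neg h).continuousAt.continuousWithinAt

theorem integral_log_mul_exp_neg_Ioi :
    ∫ t in Set.Ioi (1 : ℝ), log t * rexp (-t) = ∫ t in Set.Ioi (1 : ℝ), rexp (-t) / t := by
  have hd : ∀ t : ℝ, 0 < t → HasDerivAt (fun t => log t * rexp (-t))
      (rexp (-t) / t - log t * rexp (-t)) t := fun t ht => by
    refine ((hasDerivAt_log ht.ne').mul (hasDerivAt_neg t).exp).congr_deriv ?_
    ring
  have := integral_Ioi_of_hasDerivAt_of_tendsto (f := fun t => log t * rexp (-t))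
    (hd 1 one_pos).continuousAt.continuousWithinAt
    (fun t ht => hd t (one_pos.trans ht))
    (integrableOn_exp_neg_div.sub integrableOn_log_mul_exp_neg_Ioi) (m := 0) ?_
  · rw [integral_sub integrableOn_exp_neg_div integrableOn_log_mul_exp_neg_Ioi] at this
    simp [sub_eq_zero] at this
    exact this.symm
  · have hlim := Real.tendsto_pow_mul_exp_neg_atTop_nhds_zero 1
    refine squeeze_zero' ?_ ?_ hlim
    · filter_upwards [Filter.eventually_ge_atTop 1] with t ht
      exact mul_nonneg (log_nonneg ht) (Real.exp_pos _).le
    · filter_upwards [Filter.eventually_ge_atTop 1] with t ht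
      gcongr
      simpa using log_le_self (x := t) (by linarith)

/-- The finite part of `∫ e⁻ᵗ / t` over `(0, ∞)` is `-γ`. -/
theorem integral_exp_neg_finitePart :
    (∫ t in Set.Ioc (0 : ℝ) 1, (rexp (-t) - 1) / t) + ∫ t in Set.Ioi (1 : ℝ), rexp (-t) / t =
      -eulerMascheroniConstant := by
  rw [← integral_log_mul_exp_neg_Ioc, ← integral_log_mul_exp_neg_Ioi, ← integral_log_mul_exp_neg,
    ← Set.Ioc_union_Ioi_eq_Ioi zero_le_one, setIntegral_union (Set.Ioc_disjoint_Ioi le_rfl)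
      measurableSet_Ioi integrableOn_log_mul_exp_neg_Ioc integrableOn_log_mul_exp_neg_Ioi]

theorem fourierT_eq_fourier (φ : SchwartzMap ℝ ℂ) (k : ℝ) :
    fourierT φ k = FourierTransform.fourier φ (k / (2 * π)) := by
  rw [SchwartzMap.fourier_coe, Real.fourier_real_eq_integral_exp_smul, fourierT]
  refine integral_congr_ae (.of_forall fun x => ?_)
  simp only [smul_eq_mul]
  rw [mul_comm]
  congr 2
  push_cast
  have : (π : ℂ) ≠ 0 := by exact_mod_cast pi_ne_zero
  field_simp

theorem continuous_fourierT (φ : SchwartzMap ℝ ℂ) : Continuous (fourierT φ) := by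
  rw [funext (fourierT_eq_fourier φ)]
  exact (FourierTransform.fourier φ).continuous.comp (by fun_prop)

theorem integrable_fourierT (φ : SchwartzMap ℝ ℂ) : Integrable (fourierT φ) := by
  rw [funext (fourierT_eq_fourier φ)]
  exact (FourierTransform.fourier φ).integrable.comp_div (by positivity)

theorem integrable_abs_mul_norm_fourierT (φ : SchwartzMap ℝ ℂ) :
    Integrable fun x => |x| * ‖fourierT φ x‖ := by
  have h := (((FourierTransform.fourier φ).integrable_pow_mul volume 1).comp_div
    (R := 2 * π) (by positivity)).const_mul (2 * π)
  refine h.congr (.of_forall fun x => ?_)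
  simp only [fourierT_eq_fourier, pow_one, Real.norm_eq_abs, abs_div,
    abs_of_pos (show 0 < 2 * π by positivity)]
  field_simp

theorem exists_norm_fourierT_le (φ : SchwartzMap ℝ ℂ) : ∃ C, ∀ x, ‖fourierT φ x‖ ≤ C :=
  ⟨_, fun x => by
    rw [fourierT_eq_fourier]
    exact SchwartzMap.norm_le_seminorm ℝ _ _⟩

/-- Fourier inversion in the normalization of `fourierT`. -/
theorem integral_exp_mul_fourierT (φ : SchwartzMap ℝ ℂ) (t : ℝ) :
    ∫ x : ℝ, Complex.exp (-t * (Complex.I * x)) * fourierT φ x = 2 * π * φ (-t) := by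
  have h : FourierTransformInv.fourierInv (FourierTransform.fourier φ) = φ :=
    FourierTransform.fourierInv_fourier_eq φ
  have h2 := congrArg (fun ψ : SchwartzMap ℝ ℂ => ψ (-t)) h
  simp only [SchwartzMap.fourierInv_coe, Real.fourierInv_eq'] at h2
  rw [← h2]
  have h3 := Measure.integral_comp_div (fun y : ℝ =>
    Complex.exp (↑(2 * π * inner ℝ y (-t)) * Complex.I) • (FourierTransform.fourier φ) y) (2 * π)
  rw [abs_of_pos (by positivity), Complex.real_smul] at h3
  push_cast at h3 ⊢
  rw [← h3]
  refine integral_congr_ae (.of_forall fun x => ?_)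
  simp only [fourierT_eq_fourier, smul_eq_mul]
  congr 2
  have : (π : ℂ) ≠ 0 := by exact_mod_cast pi_ne_zero
  simp
  field_simp

/-- The claimed transform for the regularized logarithm `log (ε + i x)`. -/
theorem integral_log_mul_fourierT (φ : SchwartzMap ℝ ℂ) {ε : ℝ} (hε : 0 < ε) (hε1 : ε ≤ 1) :
    ∫ x : ℝ, Complex.log (ε + Complex.I * x) * fourierT φ x =
      2 * π * ∫ t in Set.Ioi (0 : ℝ),
        (Complex.exp (-t) * φ 0 - Complex.exp (-t * ε) * φ (-t)) / t := by
  have hre (x : ℝ) : ((ε : ℂ) + Complex.I * x).re = ε := by simp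
  have hint : Integrable (Function.uncurry fun x t : ℝ =>
      (Complex.exp (-t) - Complex.exp (-t * (ε + Complex.I * x))) / t * fourierT φ x)
      (volume.prod (volume.restrict (Set.Ioi 0))) := by
    have hx : Integrable fun x => (1 + |x|) * ‖fourierT φ x‖ := by
      simp_rw [add_mul, one_mul]
      exact (integrable_fourierT φ).norm.add (integrable_abs_mul_norm_fourierT φ)
    have hmeas := (continuous_fourierT φ).measurable
    refine (hx.mul_prod (exp_neg_integrableOn_Ioi 0 hε)).mono' ?_ ?_
    · refine Measurable.aestronglyMeasurable ?_
      unfold Function.uncurry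
      fun_prop
    · have hmem : ∀ᵐ p : ℝ × ℝ ∂(volume.prod (volume.restrict (Set.Ioi 0))), p.2 ∈ Set.Ioi 0 :=
        Measure.quasiMeasurePreserving_snd.ae (ae_restrict_mem measurableSet_Ioi)
      filter_upwards [hmem] with p hp
      have h := norm_frullani_integrand_le hp hε1 (hre p.1).ge
      have h1 : ‖1 - ((ε : ℂ) + Complex.I * p.1)‖ ≤ 1 + |p.1| := by
        rw [← sub_sub]
        refine (norm_sub_le _ _).trans (add_le_add ?_ (by simp))
        rw [← Complex.ofReal_one, ← Complex.ofReal_sub, Complex.norm_real, Real.norm_eq_abs,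
          abs_of_nonneg (by linarith)]
        linarith
      simp only [Function.uncurry, norm_mul]
      calc _ ≤ rexp (-ε * p.2) * (1 + |p.1|) * ‖fourierT φ p.1‖ := by
            gcongr
            exact h.trans (by gcongr)
        _ = _ := by ring
  calc ∫ x : ℝ, Complex.log (ε + Complex.I * x) * fourierT φ x
      = ∫ x : ℝ, ∫ t in Set.Ioi (0 : ℝ),
          (Complex.exp (-t) - Complex.exp (-t * (ε + Complex.I * x))) / t * fourierT φ x := by
        refine integral_congr_ae (.of_forall fun x => ?_)
        simp only
        rw [integral_mul_const, integral_frullani_exp (by rw [hre]; exact hε)]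
    _ = ∫ t in Set.Ioi (0 : ℝ), ∫ x : ℝ,
          (Complex.exp (-t) - Complex.exp (-t * (ε + Complex.I * x))) / t * fourierT φ x :=
        integral_integral_swap hint
    _ = ∫ t in Set.Ioi (0 : ℝ), 2 * π *
          ((Complex.exp (-t) * φ 0 - Complex.exp (-t * ε) * φ (-t)) / t) := by
        refine integral_congr_ae (.of_forall fun t => ?_)
        have h0 := integral_exp_mul_fourierT φ 0
        simp only [Complex.ofReal_zero, neg_zero, zero_mul, Complex.exp_zero, one_mul] at h0
        have hi : Integrable fun x : ℝ => Complex.exp (-t * (Complex.I * x)) * fourierT φ x := by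
          refine (integrable_fourierT φ).bdd_mul (c := 1) (by fun_prop) (.of_forall fun x => ?_)
          simp [Complex.norm_exp]
        calc _ = ∫ x : ℝ, (Complex.exp (-t) / t * fourierT φ x - Complex.exp (-t * ε) / t *
              (Complex.exp (-t * (Complex.I * x)) * fourierT φ x)) := by
              refine integral_congr_ae (.of_forall fun x => ?_)
              simp only [mul_add, Complex.exp_add]
              ring
          _ = _ := by
              rw [integral_sub ((integrable_fourierT φ).const_mul _) (hi.const_mul _),
                integral_const_mul, integral_const_mul, h0, integral_exp_mul_fourierT]
              ring
    _ = _ := integral_const_mul _ _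

theorem log_I_mul_eq_branchLog {x : ℝ} (hx : x ≠ 0) :
    Complex.log (Complex.I * x) = branchLog x + Complex.I * π / 2 := by
  rcases hx.lt_or_gt with h | h
  · have : Complex.I * x = ((-x : ℝ) : ℂ) * -Complex.I := by push_cast; ring
    rw [this, Complex.log_ofReal_mul (by linarith) (by simp), Complex.log_neg_I, branchLog,
      if_pos h, abs_of_neg h]
    ring
  · rw [mul_comm, Complex.log_ofReal_mul h Complex.I_ne_zero, Complex.log_I, branchLog,
      if_neg h.not_gt, abs_of_pos h]
    ring

theorem integrable_abs_log_mul_norm_fourierT (φ : SchwartzMap ℝ ℂ) :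
    Integrable fun x => |log x| * ‖fourierT φ x‖ := by
  obtain ⟨C, hC⟩ := exists_norm_fourierT_le φ
  have hmeas := (continuous_fourierT φ).measurable
  have hlog : IntegrableOn (fun x => |log x| * C) (Set.Icc (-1) 1) := by
    have : IntervalIntegrable log volume (-1) 1 := intervalIntegral.intervalIntegrable_log'
    rw [intervalIntegrable_iff_integrableOn_Icc_of_le (by norm_num)] at this
    exact this.abs.mul_const C
  refine ((hlog.integrable_indicator measurableSet_Icc).add
    (integrable_abs_mul_norm_fourierT φ)).mono' (by fun_prop) (.of_forall fun x => ?_)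
  rw [norm_mul, norm_norm, Real.norm_eq_abs, abs_abs, Pi.add_apply]
  by_cases hx : x ∈ Set.Icc (-1 : ℝ) 1
  · rw [Set.indicator_of_mem hx]
    have := mul_le_mul_of_nonneg_left (hC x) (abs_nonneg (log x))
    have : 0 ≤ |x| * ‖fourierT φ x‖ := by positivity
    linarith
  · rw [Set.indicator_of_notMem hx, zero_add]
    refine mul_le_mul_of_nonneg_right ?_ (norm_nonneg _)
    have hx1 : 1 ≤ |x| := by
      by_contra! h
      exact hx (abs_le.1 h.le)
    rw [← log_abs, abs_of_nonneg (log_nonneg hx1)]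
    exact log_le_self (abs_nonneg x)

theorem norm_log_add_I_mul_le {ε x : ℝ} (hε : 0 < ε) (hε1 : ε ≤ 1) (hx : x ≠ 0) :
    ‖Complex.log (ε + Complex.I * x)‖ ≤ |log x| + |x| + π := by
  set z : ℂ := ε + Complex.I * x with hz
  have h1 : |x| ≤ ‖z‖ := by simpa [hz] using Complex.abs_im_le_norm z
  have h2 : ‖z‖ ≤ 1 + |x| := by
    refine (norm_add_le _ _).trans (add_le_add ?_ (by simp))
    rwa [Complex.norm_real, Real.norm_of_nonneg hε.le]
  have hx' : 0 < |x| := abs_pos.2 hx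
  have h3 : |log ‖z‖| ≤ |log x| + |x| := by
    rw [abs_le]
    constructor
    · have := log_le_log hx' h1
      rw [log_abs] at this
      linarith [neg_abs_le (log x)]
    · have := log_le_sub_one_of_pos (hx'.trans_le h1)
      linarith [abs_nonneg (log x)]
  refine (Complex.norm_le_abs_re_add_abs_im _).trans (add_le_add ?_ ?_)
  · rwa [Complex.log_re]
  · rw [Complex.log_im]
    exact Complex.abs_arg_le_pi z

theorem tendsto_integral_log_mul_fourierT (φ : SchwartzMap ℝ ℂ) :
    Filter.Tendsto (fun ε : ℝ => ∫ x : ℝ, Complex.log (ε + Complex.I * x) * fourierT φ x)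
      (nhdsWithin 0 (Set.Ioi 0))
      (nhds (∫ x : ℝ, (branchLog x + Complex.I * π / 2) * fourierT φ x)) := by
  have hmeas := (continuous_fourierT φ).measurable
  have hne : ∀ᵐ x : ℝ, x ≠ 0 := Measure.ae_ne volume 0
  refine tendsto_integral_filter_of_dominated_convergence
    (fun x => (|log x| + |x| + π) * ‖fourierT φ x‖) (.of_forall fun ε => ?_) ?_ ?_ ?_
  · exact Measurable.aestronglyMeasurable (by fun_prop)
  · filter_upwards [Ioc_mem_nhdsGT (zero_lt_one' ℝ)] with ε hε
    filter_upwards [hne] with x hx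
    rw [norm_mul]
    gcongr
    exact norm_log_add_I_mul_le hε.1 hε.2 hx
  · simp_rw [add_mul]
    exact ((integrable_abs_log_mul_norm_fourierT φ).add
      (integrable_abs_mul_norm_fourierT φ)).add ((integrable_fourierT φ).norm.const_mul π)
  · filter_upwards [hne] with x hx
    rw [← log_I_mul_eq_branchLog hx]
    refine Filter.Tendsto.mul_const _ ?_
    have hc : ContinuousAt (fun ε : ℝ => Complex.log (ε + Complex.I * x)) 0 := by
      refine ContinuousAt.clog (by fun_prop) (.inr ?_)
      simpa using hx
    have := hc.tendsto
    simp only [Complex.ofReal_zero, zero_add] at this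
    exact this.mono_left nhdsWithin_le_nhds

theorem integrable_branchLog_mul_fourierT (φ : SchwartzMap ℝ ℂ) :
    Integrable fun x => branchLog x * fourierT φ x := by
  have hmeas := (continuous_fourierT φ).measurable
  have hb : Measurable branchLog := by
    unfold branchLog
    exact Measurable.ite measurableSet_Iio (by fun_prop) (by fun_prop)
  refine ((integrable_abs_log_mul_norm_fourierT φ).add
    ((integrable_fourierT φ).norm.const_mul π)).mono' (by fun_prop) (.of_forall fun x => ?_)
  rw [norm_mul, Pi.add_apply, ← add_mul]
  gcongr
  unfold branchLog
  split_ifs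
  · refine (norm_sub_le _ _).trans (le_of_eq ?_)
    simp [abs_of_pos pi_pos]
  · simp [pi_pos.le]

theorem exists_norm_sub_le (φ : SchwartzMap ℝ ℂ) : ∃ C, ∀ x y, ‖φ x - φ y‖ ≤ C * ‖x - y‖ := by
  refine ⟨SchwartzMap.seminorm ℝ 0 0 (SchwartzMap.derivCLM ℝ ℂ φ), fun x y => ?_⟩
  exact Convex.norm_image_sub_le_of_norm_deriv_le (s := Set.univ)
    (fun z _ => φ.differentiableAt)
    (fun z _ => (SchwartzMap.norm_le_seminorm ℝ (SchwartzMap.derivCLM ℝ ℂ φ) z))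
    convex_univ trivial trivial

theorem exists_integrable_bound_finitePart (φ : SchwartzMap ℝ ℂ) :
    ∃ b : ℝ → ℝ, IntegrableOn b (Set.Ioi 0) ∧ ∀ ε : ℝ, 0 ≤ ε → ε ≤ 1 → ∀ t : ℝ, 0 < t →
      ‖(Complex.exp (-t) * φ 0 - Complex.exp (-t * ε) * φ (-t)) / t‖ ≤ b t := by
  obtain ⟨C, hC⟩ := exists_norm_sub_le φ
  set M := SchwartzMap.seminorm ℝ 0 0 φ
  have hM : ∀ x, ‖φ x‖ ≤ M := SchwartzMap.norm_le_seminorm ℝ φ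
  have hM0 : 0 ≤ M := (norm_nonneg _).trans (hM 0)
  have hC0 : 0 ≤ C := by simpa using (norm_nonneg _).trans (hC 1 0)
  have hexp : IntegrableOn (fun t : ℝ => rexp (-t)) (Set.Ioi 0) := integrableOn_exp_neg_Ioi 0
  refine ⟨fun t => (M + C + M) * rexp 1 * rexp (-t) + M * rexp (-t) + ‖φ (-t)‖,
    ((hexp.const_mul _).add (hexp.const_mul _)).add φ.integrable.norm.comp_neg.integrableOn,
    fun ε h0 h1 t ht => ?_⟩
  have hnorm (s : ℝ) : ‖Complex.exp (-s)‖ = rexp (-s) := by simp [Complex.norm_exp]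
  have hnorm1 (s : ℝ) (hs : 0 ≤ s) : ‖Complex.exp (-s) - 1‖ ≤ s := by
    have := abs_exp_neg_sub_one_le hs
    rw [← Real.norm_eq_abs, ← Complex.norm_real] at this
    simpa using this
  rw [norm_div, Complex.norm_real, Real.norm_of_nonneg ht.le, div_le_iff₀ ht, neg_mul,
    ← Complex.ofReal_mul]
  rcases le_total t 1 with h | h
  · have hle : ‖Complex.exp (-t) * φ 0 - Complex.exp (-(t * ε : ℝ)) * φ (-t)‖
        ≤ (M + C + M) * t := by
      calc _ = ‖(Complex.exp (-t) - 1) * φ 0 + (φ 0 - φ (-t)) -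
            (Complex.exp (-(t * ε : ℝ)) - 1) * φ (-t)‖ := by congr 1; ring
        _ ≤ ‖Complex.exp (-t) - 1‖ * ‖φ 0‖ + ‖φ 0 - φ (-t)‖ +
            ‖Complex.exp (-(t * ε : ℝ)) - 1‖ * ‖φ (-t)‖ := by
          rw [← norm_mul, ← norm_mul]
          exact (norm_sub_le _ _).trans (by gcongr; exact norm_add_le _ _)
        _ ≤ t * M + C * t + t * M := by
          gcongr
          · exact hnorm1 t ht.le
          · exact hM 0
          · simpa [abs_of_pos ht] using hC 0 (-t)
          · exact (hnorm1 _ (by positivity)).trans (mul_le_of_le_one_right ht.le h1)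
          · exact hM (-t)
        _ = _ := by ring
    refine hle.trans ?_
    gcongr
    have hone : 1 ≤ rexp 1 * rexp (-t) := by
      rw [← Real.exp_add]
      exact Real.one_le_exp (by linarith)
    have hmul := le_mul_of_one_le_right (show 0 ≤ M + C + M by positivity) hone
    have : 0 ≤ M * rexp (-t) := by positivity
    linarith [norm_nonneg (φ (-t))]
  · calc _ ≤ rexp (-t) * M + 1 * ‖φ (-t)‖ := by
          refine (norm_sub_le _ _).trans ?_
          rw [norm_mul, norm_mul, hnorm, hnorm]
          gcongr
          · exact hM 0
          · exact Real.exp_le_one_iff.2 (by simp; positivity)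
      _ ≤ (M + C + M) * rexp 1 * rexp (-t) + M * rexp (-t) + ‖φ (-t)‖ := by
          have : 0 ≤ (M + C + M) * rexp 1 * rexp (-t) := by positivity
          linarith
      _ ≤ _ := le_mul_of_one_le_right (by positivity) h

theorem aestronglyMeasurable_finitePart_integrand (φ : SchwartzMap ℝ ℂ) (ε : ℝ) :
    AEStronglyMeasurable
      (fun t : ℝ => (Complex.exp (-t) * φ 0 - Complex.exp (-t * ε) * φ (-t)) / t)
      (volume.restrict (Set.Ioi 0)) := by
  have := φ.continuous.measurable
  exact Measurable.aestronglyMeasurable (by fun_prop)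

theorem integrableOn_finitePart_integrand (φ : SchwartzMap ℝ ℂ) :
    IntegrableOn (fun t : ℝ => (Complex.exp (-t) * φ 0 - φ (-t)) / t) (Set.Ioi 0) := by
  obtain ⟨b, hb, hle⟩ := exists_integrable_bound_finitePart φ
  have h : IntegrableOn (fun t : ℝ => (Complex.exp (-t) * φ 0 -
      Complex.exp (-t * (0 : ℝ)) * φ (-t)) / t) (Set.Ioi 0) := by
    refine Integrable.mono' hb (aestronglyMeasurable_finitePart_integrand φ 0) ?_
    filter_upwards [ae_restrict_mem measurableSet_Ioi] with t ht
    exact hle 0 le_rfl zero_le_one t ht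
  simpa using h

theorem tendsto_integral_finitePart (φ : SchwartzMap ℝ ℂ) :
    Filter.Tendsto (fun ε : ℝ => ∫ t in Set.Ioi (0 : ℝ),
        (Complex.exp (-t) * φ 0 - Complex.exp (-t * ε) * φ (-t)) / t)
      (nhdsWithin 0 (Set.Ioi 0))
      (nhds (∫ t in Set.Ioi (0 : ℝ), (Complex.exp (-t) * φ 0 - φ (-t)) / t)) := by
  obtain ⟨b, hb, hle⟩ := exists_integrable_bound_finitePart φ
  refine tendsto_integral_filter_of_dominated_convergence b
    (.of_forall (aestronglyMeasurable_finitePart_integrand φ)) ?_ hb ?_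
  · filter_upwards [Ioc_mem_nhdsGT (zero_lt_one' ℝ)] with ε hε
    filter_upwards [ae_restrict_mem measurableSet_Ioi] with t ht
    exact hle ε hε.1.le hε.2 t ht
  · refine .of_forall fun t => ?_
    have hc : Continuous fun ε : ℝ =>
        (Complex.exp (-t) * φ 0 - Complex.exp (-t * ε) * φ (-t)) / t := by fun_prop
    have := hc.tendsto 0
    simp only [Complex.ofReal_zero, mul_zero, Complex.exp_zero, one_mul] at this
    exact this.mono_left nhdsWithin_le_nhds

theorem integral_finitePart_eq (φ : SchwartzMap ℝ ℂ) :
    ∫ t in Set.Ioi (0 : ℝ), (Complex.exp (-t) * φ 0 - φ (-t)) / t =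
      -((∫ x in Set.Ico (-1 : ℝ) 0, (φ x - φ 0) / ((|x| : ℝ) : ℂ)) +
          ∫ x in Set.Iio (-1 : ℝ), φ x / ((|x| : ℝ) : ℂ)) -
        (Real.eulerMascheroniConstant : ℂ) * φ 0 := by
  have hint := integrableOn_finitePart_integrand φ
  have hint₁ := hint.mono_set (show Set.Ioc (0 : ℝ) 1 ⊆ Set.Ioi 0 from Set.Ioc_subset_Ioi_self)
  have hint₂ := hint.mono_set (Set.Ioi_subset_Ioi (zero_le_one' ℝ))
  have he₁ : IntegrableOn (fun t : ℝ => (((rexp (-t) - 1) / t : ℝ) : ℂ)) (Set.Ioc 0 1) :=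
    integrableOn_exp_neg_sub_one_div.ofReal
  have he₂ : IntegrableOn (fun t : ℝ => ((rexp (-t) / t : ℝ) : ℂ)) (Set.Ioi 1) :=
    integrableOn_exp_neg_div.ofReal
  have hγ := congrArg (fun r : ℝ => (r : ℂ)) integral_exp_neg_finitePart
  simp only [Complex.ofReal_add, ← integral_complex_ofReal, Complex.ofReal_neg] at hγ
  have hnear : ∫ x in Set.Ico (-1 : ℝ) 0, (φ x - φ 0) / ((|x| : ℝ) : ℂ) =
      (∫ t in Set.Ioc (0 : ℝ) 1, (((rexp (-t) - 1) / t : ℝ) : ℂ)) * φ 0 -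
        ∫ t in Set.Ioc (0 : ℝ) 1, (Complex.exp (-t) * φ 0 - φ (-t)) / t := by
    rw [← integral_mul_const, ← integral_sub (he₁.mul_const _) hint₁]
    have hpre := (Measure.measurePreserving_neg (volume : Measure ℝ)).setIntegral_preimage_emb
      (MeasurableEquiv.neg ℝ).measurableEmbedding
      (fun x : ℝ => (φ x - φ 0) / ((|x| : ℝ) : ℂ)) (Set.Ico (-1) 0)
    rw [← hpre, show Neg.neg ⁻¹' Set.Ico (-1 : ℝ) 0 = Set.Ioc 0 1 by simp]
    refine setIntegral_congr_fun measurableSet_Ioc fun t ht => ?_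
    simp only [abs_neg, abs_of_pos ht.1]
    push_cast
    ring
  have hfar : ∫ x in Set.Iio (-1 : ℝ), φ x / ((|x| : ℝ) : ℂ) =
      (∫ t in Set.Ioi (1 : ℝ), ((rexp (-t) / t : ℝ) : ℂ)) * φ 0 -
        ∫ t in Set.Ioi (1 : ℝ), (Complex.exp (-t) * φ 0 - φ (-t)) / t := by
    rw [← integral_mul_const, ← integral_sub (he₂.mul_const _) hint₂, ← integral_Iic_eq_integral_Iio,
      ← integral_comp_neg_Ioi 1 (fun x : ℝ => φ x / ((|x| : ℝ) : ℂ))]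
    refine setIntegral_congr_fun measurableSet_Ioi fun t ht => ?_
    simp only [abs_neg, abs_of_pos (zero_lt_one.trans (Set.mem_Ioi.1 ht))]
    push_cast
    ring
  rw [hnear, hfar, ← Set.Ioc_union_Ioi_eq_Ioi zero_le_one,
    setIntegral_union (Set.Ioc_disjoint_Ioi le_rfl) measurableSet_Ioi hint₁ hint₂]
  linear_combination φ 0 * hγ

/-- Distributional Fourier transform of `log x` (branch `log(−1) = −iπ`):
`∫ L(x) φ̂(x) dx = −2π·Pf(H(−x)/|x|)[φ] − (2πγ + iπ²) φ(0)`, where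
`Pf(H(−x)/|x|)[φ] = ∫_{−1≤x<0}(φ(x)−φ(0))/|x| dx + ∫_{x<−1} φ(x)/|x| dx`
and `γ` is the Euler–Mascheroni constant. -/
theorem fourier_branch_log (φ : SchwartzMap ℝ ℂ) :
    ∫ x : ℝ, branchLog x * fourierT φ x =
      -2 * (π : ℂ) * ((∫ x in Set.Ico (-1 : ℝ) 0, (φ x - φ 0) / ((|x| : ℝ) : ℂ)) +
          ∫ x in Set.Iio (-1 : ℝ), φ x / ((|x| : ℝ) : ℂ)) -
        (2 * (π : ℂ) * (Real.eulerMascheroniConstant : ℂ) + Complex.I * (π : ℂ) ^ 2) * φ 0 := by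
  have hlim := (tendsto_integral_finitePart φ).const_mul (2 * π : ℂ)
  have heq := tendsto_nhds_unique (tendsto_integral_log_mul_fourierT φ) (hlim.congr' (by
    filter_upwards [Ioc_mem_nhdsGT (zero_lt_one' ℝ)] with ε hε
    exact (integral_log_mul_fourierT φ hε.1 hε.2).symm))
  have hmass := integral_exp_mul_fourierT φ 0
  simp only [Complex.ofReal_zero, neg_zero, zero_mul, Complex.exp_zero, one_mul] at hmass
  simp_rw [add_mul] at heq
  rw [integral_add (integrable_branchLog_mul_fourierT φ) ((integrable_fourierT φ).const_mul _),
    integral_const_mul, hmass, integral_finitePart_eq] at heq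
  linear_combination heq
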